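/- Let N = N_{k₁}(x^1) + ⋯ + N_{k_n}(x^n) be a direct sum of normalized nilpotent blocks N_{k_j}(x^j) = Σ_{i=1}^{k_j} √(i(k_j+1−i)) x^j_{i+1} ∂/∂x^j_i on ℂ^m. For each δ ≥ 1, let d₀ : 𝒱_δ → 𝒱_δ be the Lie operator U ↦ [U, N] and d₀* its adjoint with respect to the Fischer inner product, and let □_δ = d₀ d₀*. Then every nonzero eigenvalue of □_δ is a positive integer; consequently a_δ := min{√λ : λ a nonzero eigenvalue of □_δ} ≥ 1 for all δ, i.e. N satisfies the Siegel condition of order (τ, γ) = (0, 1). -/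

import Mathlib

open MvPolynomial

/-- The Fischer inner product on polynomials:
`⟨Σ a_α x^α, Σ b_β x^β⟩ = Σ_α a_α conj(b_α) α!/|α|!`. -/
noncomputable def fischerInner {σ : Type*} (P Q : MvPolynomial σ ℂ) : ℂ :=
  ∑ α ∈ P.support, P.coeff α * (starRingEnd ℂ) (Q.coeff α) *
    (((α.prod fun _ m => m.factorial : ℕ) : ℂ) / (((α.sum fun _ m => m).factorial : ℕ) : ℂ))

/-- The componentwise Fischer inner product on polynomial vector fields. -/
noncomputable def fischerInnerVF {σ : Type*} [Fintype σ]
    (V W : σ → MvPolynomial σ ℂ) : ℂ :=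
  ∑ k, fischerInner (V k) (W k)

/-- The Lie bracket of polynomial vector fields:
`[U, V]_i = Σ_j (U_j ∂V_i/∂x_j − V_j ∂U_i/∂x_j)`. -/
noncomputable def vfBracket {σ : Type*} [Fintype σ]
    (U V : σ → MvPolynomial σ ℂ) : σ → MvPolynomial σ ℂ :=
  fun i => ∑ j, (U j * pderiv j (V i) - V j * pderiv j (U i))

/-- A polynomial vector field is homogeneous of degree `d` when each component is. -/
def vfIsHomogeneous {σ : Type*} (V : σ → MvPolynomial σ ℂ) (d : ℕ) : Prop :=
  ∀ i, (V i).IsHomogeneous d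

section Fischer

variable {σ : Type*}

/-- The weight `α!/|α|!` of the monomial `x^α` in the Fischer inner product. -/
noncomputable def fischerWeight (α : σ →₀ ℕ) : ℝ :=
  ((α.prod fun _ m => m.factorial : ℕ) : ℝ) / (((α.sum fun _ m => m).factorial : ℕ) : ℝ)

lemma fischerWeight_pos (α : σ →₀ ℕ) : 0 < fischerWeight α :=
  div_pos (Nat.cast_pos.2 <| Finset.prod_pos fun _ _ => Nat.factorial_pos _)
    (Nat.cast_pos.2 <| Nat.factorial_pos _)

lemma fischerWeight_add_single [Fintype σ] [DecidableEq σ] (γ : σ →₀ ℕ) (a : σ) :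
    fischerWeight (γ + Finsupp.single a 1) =
      (γ a + 1) * ((∏ i, ((γ i).factorial : ℝ)) / ((∑ i, γ i) + 1).factorial) := by
  have hs : ((γ + Finsupp.single a 1).sum fun _ m => m) = (∑ i, γ i) + 1 := by
    rw [Finsupp.sum_fintype _ _ (fun _ => rfl)]
    simp [Finset.sum_add_distrib, Finsupp.single_apply]
  have hp : ((γ + Finsupp.single a 1).prod fun _ m => m.factorial) =
      (γ a + 1) * ∏ i, (γ i).factorial := by
    rw [Finsupp.prod_fintype _ _ (fun _ => rfl), ← Finset.mul_prod_erase _ _ (Finset.mem_univ a),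
      ← Finset.mul_prod_erase _ (fun i => (γ i).factorial) (Finset.mem_univ a), ← mul_assoc]
    congr 1
    · simp [Nat.factorial_succ]
    · refine Finset.prod_congr rfl fun i hi => ?_
      simp [(Finset.ne_of_mem_erase hi).symm]
  rw [fischerWeight, hs, hp]
  push_cast
  ring

lemma fischerInner_eq_sum {P : MvPolynomial σ ℂ} (Q : MvPolynomial σ ℂ) {S : Finset (σ →₀ ℕ)}
    (hS : P.support ⊆ S) :
    fischerInner P Q =
      ∑ α ∈ S, P.coeff α * (starRingEnd ℂ) (Q.coeff α) * (fischerWeight α : ℂ) := by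
  rw [fischerInner, ← Finset.sum_subset hS]
  · refine Finset.sum_congr rfl fun α _ => ?_
    rw [fischerWeight, Complex.ofReal_div, Complex.ofReal_natCast, Complex.ofReal_natCast]
  · intro α _ hα
    simp [notMem_support_iff.1 hα]

lemma fischerInner_add_left (P P' Q : MvPolynomial σ ℂ) :
    fischerInner (P + P') Q = fischerInner P Q + fischerInner P' Q := by
  classical
  rw [fischerInner_eq_sum Q (support_add (p := P) (q := P')),
    fischerInner_eq_sum Q (Finset.subset_union_left (s₁ := P.support) (s₂ := P'.support)),
    fischerInner_eq_sum Q (Finset.subset_union_right (s₁ := P.support) (s₂ := P'.support)),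
    ← Finset.sum_add_distrib]
  exact Finset.sum_congr rfl fun α _ => by rw [coeff_add]; ring

lemma fischerInner_smul_left (c : ℂ) (P Q : MvPolynomial σ ℂ) :
    fischerInner (c • P) Q = c * fischerInner P Q := by
  rw [fischerInner_eq_sum Q (support_smul (a := c) (f := P)),
    fischerInner_eq_sum Q (subset_refl P.support), Finset.mul_sum]
  exact Finset.sum_congr rfl fun α _ => by rw [coeff_smul, smul_eq_mul]; ring

lemma fischerInner_add_right (P Q Q' : MvPolynomial σ ℂ) :
    fischerInner P (Q + Q') = fischerInner P Q + fischerInner P Q' := by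
  simp only [fischerInner, coeff_add, map_add, mul_add, add_mul, Finset.sum_add_distrib]

lemma fischerInner_smul_right (c : ℂ) (P Q : MvPolynomial σ ℂ) :
    fischerInner P (c • Q) = starRingEnd ℂ c * fischerInner P Q := by
  simp only [fischerInner, coeff_smul, smul_eq_mul, map_mul, Finset.mul_sum]
  exact Finset.sum_congr rfl fun α _ => by ring

/-- `fischerInner · Q` as a linear map. -/
noncomputable def fischerInnerLeft (Q : MvPolynomial σ ℂ) : MvPolynomial σ ℂ →ₗ[ℂ] ℂ where
  toFun P := fischerInner P Q
  map_add' P P' := fischerInner_add_left P P' Q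
  map_smul' c P := fischerInner_smul_left c P Q

/-- `fischerInner P ·` as a conjugate-linear map. -/
noncomputable def fischerInnerRight (P : MvPolynomial σ ℂ) :
    MvPolynomial σ ℂ →ₛₗ[starRingEnd ℂ] ℂ where
  toFun Q := fischerInner P Q
  map_add' Q Q' := fischerInner_add_right P Q Q'
  map_smul' c Q := fischerInner_smul_right c P Q

lemma fischerInner_sub_left (P P' Q : MvPolynomial σ ℂ) :
    fischerInner (P - P') Q = fischerInner P Q - fischerInner P' Q :=
  map_sub (fischerInnerLeft Q) P P'

lemma fischerInner_sub_right (P Q Q' : MvPolynomial σ ℂ) :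
    fischerInner P (Q - Q') = fischerInner P Q - fischerInner P Q' :=
  map_sub (fischerInnerRight P) Q Q'

lemma fischerInner_sum_left {ι : Type*} (s : Finset ι) (P : ι → MvPolynomial σ ℂ)
    (Q : MvPolynomial σ ℂ) : fischerInner (∑ i ∈ s, P i) Q = ∑ i ∈ s, fischerInner (P i) Q :=
  map_sum (fischerInnerLeft Q) P s

lemma fischerInner_sum_right {ι : Type*} (s : Finset ι) (P : MvPolynomial σ ℂ)
    (Q : ι → MvPolynomial σ ℂ) : fischerInner P (∑ i ∈ s, Q i) = ∑ i ∈ s, fischerInner P (Q i) :=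
  map_sum (fischerInnerRight P) Q s

lemma fischerInner_monomial (α : σ →₀ ℕ) (c : ℂ) (Q : MvPolynomial σ ℂ) :
    fischerInner (monomial α c) Q = c * starRingEnd ℂ (Q.coeff α) * (fischerWeight α : ℂ) := by
  classical
  rw [fischerInner_eq_sum Q support_monomial_subset, Finset.sum_singleton, coeff_monomial, if_pos rfl]

lemma fischerInner_self (P : MvPolynomial σ ℂ) :
    fischerInner P P = ((∑ α ∈ P.support, ‖P.coeff α‖ ^ 2 * fischerWeight α : ℝ) : ℂ) := by
  rw [fischerInner_eq_sum P (subset_refl _)]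
  push_cast
  exact Finset.sum_congr rfl fun α _ => by rw [Complex.mul_conj']

lemma fischerInner_self_re_nonneg (P : MvPolynomial σ ℂ) : 0 ≤ (fischerInner P P).re := by
  rw [fischerInner_self, Complex.ofReal_re]
  exact Finset.sum_nonneg fun α _ => mul_nonneg (sq_nonneg _) (fischerWeight_pos α).le

lemma fischerInner_self_re_pos {P : MvPolynomial σ ℂ} (hP : P ≠ 0) :
    0 < (fischerInner P P).re := by
  rw [fischerInner_self, Complex.ofReal_re]
  refine Finset.sum_pos (fun α hα => mul_pos (pow_pos ?_ 2) (fischerWeight_pos α))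
    (support_nonempty.2 hP)
  exact norm_pos_iff.2 (mem_support_iff.1 hα)

/-- The operators `x_a ∂_b` and `x_b ∂_a` are adjoint for the Fischer inner product. -/
lemma fischerInner_X_mul_pderiv [Fintype σ] (a b : σ) (P Q : MvPolynomial σ ℂ) :
    fischerInner P (X a * pderiv b Q) = fischerInner (X b * pderiv a P) Q := by
  classical
  induction P using MvPolynomial.induction_on' with
  | add P P' h h' => rw [fischerInner_add_left, h, h', map_add, mul_add, fischerInner_add_left]
  | monomial α c =>
    by_cases hα : α a = 0
    · rw [fischerInner_monomial, coeff_X_mul', if_neg (by simpa using hα), pderiv_monomial, hα]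
      simp [fischerInner]
    · obtain ⟨γ, rfl⟩ : ∃ γ : σ →₀ ℕ, α = γ + Finsupp.single a 1 :=
        ⟨α - Finsupp.single a 1, by
          rw [tsub_add_cancel_of_le]
          exact Finsupp.single_le_iff.2 (Nat.one_le_iff_ne_zero.2 hα)⟩
      have h : X b * pderiv a (monomial (γ + Finsupp.single a 1) c) =
          monomial (γ + Finsupp.single b 1) (c * (γ a + 1)) := by
        rw [pderiv_monomial, add_tsub_cancel_right, X, monomial_mul, add_comm γ]
        simp [add_comm]
      rw [h, fischerInner_monomial, fischerInner_monomial, add_comm γ, coeff_X_mul, coeff_pderiv,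
        add_comm _ γ, fischerWeight_add_single, fischerWeight_add_single]
      simp only [Complex.ofReal_mul, map_mul, map_add, map_natCast, map_one, Complex.ofReal_add,
        Complex.ofReal_natCast, Complex.ofReal_one]
      ring

variable [Fintype σ]

lemma fischerInnerVF_self_re_nonneg (V : σ → MvPolynomial σ ℂ) :
    0 ≤ (fischerInnerVF V V).re := by
  rw [fischerInnerVF, Complex.re_sum]
  exact Finset.sum_nonneg fun i _ => fischerInner_self_re_nonneg (V i)

lemma fischerInnerVF_self_re_pos {V : σ → MvPolynomial σ ℂ} (hV : V ≠ 0) :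
    0 < (fischerInnerVF V V).re := by
  obtain ⟨i, hi⟩ := Function.ne_iff.1 hV
  rw [fischerInnerVF, Complex.re_sum]
  exact Finset.sum_pos' (fun j _ => fischerInner_self_re_nonneg (V j))
    ⟨i, Finset.mem_univ i, fischerInner_self_re_pos hi⟩

lemma fischerInnerVF_sub_left (V V' W : σ → MvPolynomial σ ℂ) :
    fischerInnerVF (V - V') W = fischerInnerVF V W - fischerInnerVF V' W := by
  simp only [fischerInnerVF, Pi.sub_apply, fischerInner_sub_left, Finset.sum_sub_distrib]

lemma fischerInnerVF_smul_right (c : ℂ) (V W : σ → MvPolynomial σ ℂ) :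
    fischerInnerVF V (c • W) = starRingEnd ℂ c * fischerInnerVF V W := by
  simp only [fischerInnerVF, Pi.smul_apply, fischerInner_smul_right, Finset.mul_sum]

end Fischer

section Homogeneous

/-- Homogeneous polynomial vector fields of degree `d`. -/
noncomputable def homogeneousVF (σ : Type*) (d : ℕ) : Submodule ℂ (σ → MvPolynomial σ ℂ) :=
  Submodule.pi Set.univ fun _ => homogeneousSubmodule σ ℂ d

variable {σ : Type*}

lemma mem_homogeneousVF {d : ℕ} {V : σ → MvPolynomial σ ℂ} :
    V ∈ homogeneousVF σ d ↔ vfIsHomogeneous V d := by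
  simp [homogeneousVF, vfIsHomogeneous, Submodule.mem_pi, mem_homogeneousSubmodule]

lemma homogeneousVF_fg [Finite σ] (d : ℕ) : (homogeneousVF σ d).FG :=
  Submodule.fg_pi fun _ => homogeneousSubmodule_fg σ ℂ d

lemma coeff_X_mul_pderiv (j : σ) (P : MvPolynomial σ ℂ) (α : σ →₀ ℕ) :
    coeff α (X j * pderiv j P) = α j * coeff α P := by
  classical
  by_cases hα : α j = 0
  · rw [coeff_X_mul', if_neg (by simpa using hα), hα, Nat.cast_zero, zero_mul]
  · obtain ⟨γ, rfl⟩ : ∃ γ : σ →₀ ℕ, α = Finsupp.single j 1 + γ :=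
      ⟨α - Finsupp.single j 1, (add_tsub_cancel_of_le <|
        Finsupp.single_le_iff.2 (Nat.one_le_iff_ne_zero.2 hα)).symm⟩
    rw [coeff_X_mul, coeff_pderiv, add_comm γ]
    simp [add_comm, mul_comm]

end Homogeneous

section Bracket

variable {σ : Type*} [Fintype σ]

lemma mkDerivation_eq_sum_pderiv (U : σ → MvPolynomial σ ℂ) (P : MvPolynomial σ ℂ) :
    mkDerivation ℂ U P = ∑ j, U j * pderiv j P := by
  classical
  have hs (P : MvPolynomial σ ℂ) :
      (∑ j, U j • pderiv (R := ℂ) j) P = ∑ j, U j * pderiv j P := by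
    rw [← Derivation.coeFnAddMonoidHom_apply, map_sum, Finset.sum_apply]
    rfl
  have h : mkDerivation ℂ U = ∑ j, U j • pderiv (R := ℂ) j := by
    refine derivation_ext fun i => ?_
    rw [mkDerivation_X, hs]
    simp [pderiv_X, Pi.single_apply]
  rw [h, hs]

lemma vfBracket_apply (U V : σ → MvPolynomial σ ℂ) (i : σ) :
    vfBracket U V i = mkDerivation ℂ U (V i) - mkDerivation ℂ V (U i) := by
  rw [vfBracket, Finset.sum_sub_distrib, mkDerivation_eq_sum_pderiv, mkDerivation_eq_sum_pderiv]

lemma mkDerivation_vfBracket (U V : σ → MvPolynomial σ ℂ) :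
    mkDerivation ℂ (vfBracket U V) = ⁅mkDerivation ℂ U, mkDerivation ℂ V⁆ := by
  refine derivation_ext fun i => ?_
  rw [mkDerivation_X, vfBracket_apply, Derivation.commutator_apply, mkDerivation_X, mkDerivation_X]

lemma vfBracket_jacobi (U V W : σ → MvPolynomial σ ℂ) :
    vfBracket (vfBracket U V) W - vfBracket (vfBracket U W) V = vfBracket (vfBracket W V) U := by
  have h : Function.Injective (mkDerivation ℂ : (σ → MvPolynomial σ ℂ) → _) :=
    (mkDerivationEquiv ℂ (σ := σ) (A := MvPolynomial σ ℂ)).injective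
  have hsub (P Q : σ → MvPolynomial σ ℂ) :
      mkDerivation ℂ (P - Q) = mkDerivation ℂ P - mkDerivation ℂ Q :=
    map_sub (mkDerivationEquiv ℂ) P Q
  apply h
  simp only [hsub, mkDerivation_vfBracket]
  ext1 i
  simp only [Derivation.sub_apply, Derivation.commutator_apply, map_sub]
  ring

lemma vfBracket_skew (U V : σ → MvPolynomial σ ℂ) : vfBracket U V = -vfBracket V U := by
  ext1 i
  rw [Pi.neg_apply, vfBracket_apply, vfBracket_apply, neg_sub]

/-- The operator `U ↦ [U, V]` on polynomial vector fields. -/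
noncomputable def vfBracketRight (V : σ → MvPolynomial σ ℂ) :
    Module.End ℂ (σ → MvPolynomial σ ℂ) where
  toFun U := vfBracket U V
  map_add' U U' := by
    ext1 i
    simp only [vfBracket, Pi.add_apply, ← Finset.sum_add_distrib, map_add]
    exact Finset.sum_congr rfl fun j _ => by ring
  map_smul' c U := by
    ext1 i
    simp only [vfBracket, Pi.smul_apply, Finset.smul_sum, RingHom.id_apply, Derivation.map_smul,
      smul_sub, smul_mul_assoc, mul_smul_comm]

@[simp]
lemma vfBracketRight_apply (U V : σ → MvPolynomial σ ℂ) : vfBracketRight V U = vfBracket U V :=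
  rfl

lemma vfBracket_smul_right (c : ℂ) (U V : σ → MvPolynomial σ ℂ) :
    vfBracket U (c • V) = c • vfBracket U V := by
  rw [vfBracket_skew, ← vfBracketRight_apply, map_smul, vfBracketRight_apply, vfBracket_skew V,
    smul_neg, neg_neg]

/-- The linear vector field `x ↦ A x`. -/
noncomputable def linVF (A : Matrix σ σ ℂ) : σ → MvPolynomial σ ℂ :=
  fun i => ∑ j, A i j • X j

lemma linVF_smul (c : ℂ) (A : Matrix σ σ ℂ) : linVF (c • A) = c • linVF A := by
  ext1 i
  simp [linVF, Finset.smul_sum, smul_smul]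

variable [DecidableEq σ]

lemma pderiv_linVF (A : Matrix σ σ ℂ) (i j : σ) : pderiv j (linVF A i) = C (A i j) := by
  simp [linVF, pderiv_X, Pi.single_apply, smul_eq_C_mul]

lemma vfBracket_linVF (A B : Matrix σ σ ℂ) :
    vfBracket (linVF A) (linVF B) = linVF (B * A - A * B) := by
  ext1 i
  have h (A B : Matrix σ σ ℂ) : ∑ j, linVF A j * C (B i j) = ∑ l, (B * A) i l • X l := by
    simp only [linVF, Finset.sum_mul, Matrix.mul_apply, Finset.sum_smul]
    rw [Finset.sum_comm]
    refine Finset.sum_congr rfl fun l _ => Finset.sum_congr rfl fun j _ => ?_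
    simp only [smul_eq_C_mul, C_mul]
    ring
  simp only [vfBracket, pderiv_linVF, Finset.sum_sub_distrib, h]
  simp only [linVF, Matrix.sub_apply, sub_smul, Finset.sum_sub_distrib]

lemma vfBracket_linVF_apply (V : σ → MvPolynomial σ ℂ) (A : Matrix σ σ ℂ) (i : σ) :
    vfBracket V (linVF A) i =
      (∑ j, A i j • V j) - ∑ j, ∑ l, A j l • (X l * pderiv j (V i)) := by
  simp only [vfBracket, pderiv_linVF, Finset.sum_sub_distrib]
  congr 1
  · simp [smul_eq_C_mul, mul_comm]
  · simp [linVF, Finset.sum_mul]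

/-- The Fischer adjoint of bracketing with `x ↦ A x` is bracketing with `x ↦ Aᴴ x`. -/
lemma fischerInnerVF_vfBracket_linVF (A : Matrix σ σ ℂ) (V W : σ → MvPolynomial σ ℂ) :
    fischerInnerVF (vfBracket V (linVF A.conjTranspose)) W =
      fischerInnerVF V (vfBracket W (linVF A)) := by
  simp only [fischerInnerVF, vfBracket_linVF_apply, fischerInner_sub_left, fischerInner_sub_right,
    fischerInner_sum_left, fischerInner_sum_right, fischerInner_smul_left, fischerInner_smul_right,
    Finset.sum_sub_distrib, fischerInner_X_mul_pderiv, Matrix.conjTranspose_apply, ← starRingEnd_apply]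
  congr 1
  · exact Finset.sum_comm
  · exact Finset.sum_congr rfl fun i _ => Finset.sum_comm

lemma vfBracket_linVF_mem {d : ℕ} (A : Matrix σ σ ℂ) {V : σ → MvPolynomial σ ℂ}
    (hV : V ∈ homogeneousVF σ (d + 1)) : vfBracket V (linVF A) ∈ homogeneousVF σ (d + 1) := by
  rw [mem_homogeneousVF] at hV ⊢
  intro i
  rw [vfBracket_linVF_apply, ← mem_homogeneousSubmodule]
  refine sub_mem (sum_mem fun j _ => Submodule.smul_mem _ _ (hV j))
    (sum_mem fun j _ => sum_mem fun l _ => Submodule.smul_mem _ _ ?_)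
  rw [mem_homogeneousSubmodule, add_comm]
  exact (isHomogeneous_X ℂ l).mul ((hV i).pderiv (i := j))

/-- An eigenvalue of bracketing with an integral diagonal linear vector field is an integer. -/
lemma exists_int_of_vfBracket_diagonal (w : σ → ℤ) {V : σ → MvPolynomial σ ℂ} (hV : V ≠ 0)
    {c : ℂ} (h : vfBracket V (linVF (Matrix.diagonal fun i => (w i : ℂ))) = c • V) :
    ∃ z : ℤ, c = z := by
  obtain ⟨i, hi⟩ := Function.ne_iff.1 hV
  obtain ⟨α, hα⟩ := ne_zero_iff.1 hi
  refine ⟨w i - ∑ j, w j * α j, ?_⟩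
  have h1 := congrArg (coeff α) (congrFun h i)
  simp only [vfBracket_linVF_apply, Matrix.diagonal_apply, ite_smul, zero_smul, Finset.sum_ite_eq,
    Finset.mem_univ, if_true, coeff_sub, coeff_sum, coeff_smul, coeff_X_mul_pderiv, smul_eq_mul,
    Pi.smul_apply] at h1
  refine mul_right_cancel₀ hα (h1.symm.trans ?_)
  push_cast
  rw [sub_mul, Finset.sum_mul]
  simp only [mul_assoc]

end Bracket

/-- The Casimir argument for `sl₂`: if `E F - F E = H` and `H E - E H = 2 E`, and the eigenvalues
of `E F` on the `E`-stable subspace `p` have non-negative real part, then the eigenvalue of `E F`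
at a weight vector of integral weight is an integer. -/
lemma exists_int_of_sl2_weight_vector {M : Type*} [AddCommGroup M] [Module ℂ M]
    {E F H : Module.End ℂ M} (hEF : ∀ v, E (F v) - F (E v) = H v)
    (hHE : ∀ v, H (E v) - E (H v) = (2 : ℂ) • E v)
    {p : Submodule ℂ M} (hE : ∀ v ∈ p, E v ∈ p)
    (hp : ∀ v ∈ p, v ≠ 0 → ∀ μ : ℂ, E (F v) = μ • v → 0 ≤ μ.re)
    {v : M} (hv : v ∈ p) (hv0 : v ≠ 0) {μ : ℂ} (hμ : E (F v) = μ • v)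
    {l : ℤ} (hl : H v = (l : ℂ) • v) : ∃ m : ℤ, μ = m := by
  by_contra hm
  have key (j : ℕ) : ∃ u ∈ p, u ≠ 0 ∧ E (F u) = (μ - (j * l + j * (j - 1) : ℤ)) • u ∧
      H u = ((l + 2 * j : ℤ) : ℂ) • u := by
    induction j with
    | zero => exact ⟨v, hv, hv0, by simpa using hμ, by simpa using hl⟩
    | succ j ih =>
      obtain ⟨u, hu, hu0, hEFu, hHu⟩ := ih
      have hFE : F (E u) = (μ - ((j + 1) * l + (j + 1) * j : ℤ)) • u := by
        have := hEF u
        rw [hEFu, hHu, sub_eq_iff_eq_add', ← sub_eq_iff_eq_add, ← sub_smul] at this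
        rw [← this]
        congr 1
        push_cast
        ring
      refine ⟨E u, hE u hu, fun h0 => ?_, ?_, ?_⟩
      · rw [h0, map_zero, eq_comm, smul_eq_zero, or_iff_left hu0, sub_eq_zero] at hFE
        exact hm ⟨_, hFE⟩
      · rw [hFE, map_smul]
        congr 1
        push_cast
        ring
      · have := hHE u
        rw [hHu, map_smul, sub_eq_iff_eq_add, ← add_smul] at this
        rw [this]
        congr 1
        push_cast
        ring
  have hre (j : ℕ) : (j * l + j * (j - 1) : ℝ) ≤ μ.re := by
    obtain ⟨u, hu, hu0, hEFu, -⟩ := key j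
    have := hp u hu hu0 _ hEFu
    rw [Complex.sub_re, Complex.intCast_re] at this
    push_cast at this
    linarith
  obtain ⟨j, hj⟩ := exists_nat_gt (|(l : ℝ)| + |μ.re| + 2)
  have h1 := neg_abs_le (l : ℝ)
  have h2 := le_abs_self μ.re
  have h3 := abs_nonneg (l : ℝ)
  have h4 := abs_nonneg μ.re
  nlinarith [hre j]

section Box

variable {σ : Type*} [Fintype σ] [DecidableEq σ]

lemma re_nonneg_of_box_eigenvalue (A : Matrix σ σ ℂ) {V : σ → MvPolynomial σ ℂ} (hV : V ≠ 0)
    {μ : ℂ} (h : vfBracket (vfBracket V (linVF A.conjTranspose)) (linVF A) = μ • V) :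
    0 ≤ μ.re := by
  have h1 := fischerInnerVF_vfBracket_linVF A V (vfBracket V (linVF A.conjTranspose))
  rw [h, fischerInnerVF_smul_right] at h1
  have h2 := fischerInnerVF_self_re_nonneg (vfBracket V (linVF A.conjTranspose))
  have h3 := fischerInnerVF_self_re_pos hV
  have h4 : (fischerInnerVF V V).im = 0 := by
    simp only [fischerInnerVF, fischerInner_self, Complex.im_sum, Complex.ofReal_im, Finset.sum_const_zero]
  rw [h1, Complex.mul_re, h4, mul_zero, sub_zero, Complex.conj_re] at h2
  exact nonneg_of_mul_nonneg_left h2 h3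

/-- If `A`, `Aᴴ` and an integral diagonal matrix form an `sl₂`-triple, then the eigenvalues of
the box operator of the linear vector field `x ↦ A x` are integers. -/
theorem exists_int_of_box_eigenvalue (A : Matrix σ σ ℂ) (w : σ → ℤ)
    (hw : A.conjTranspose * A - A * A.conjTranspose = Matrix.diagonal fun i => (w i : ℂ))
    (hA : A * Matrix.diagonal (fun i => (w i : ℂ)) - Matrix.diagonal (fun i => (w i : ℂ)) * A =
      (2 : ℂ) • A) {d : ℕ} {V : σ → MvPolynomial σ ℂ} (hV : V ∈ homogeneousVF σ (d + 1))
    (hV0 : V ≠ 0) {μ : ℂ}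
    (h : vfBracket (vfBracket V (linVF A.conjTranspose)) (linVF A) = μ • V) :
    ∃ m : ℤ, μ = m := by
  set D := Matrix.diagonal fun i => (w i : ℂ) with hD
  have hA' : A.conjTranspose * D - D * A.conjTranspose = (-2 : ℂ) • A.conjTranspose := by
    have hDD : D.conjTranspose = D := by
      rw [hD, Matrix.diagonal_conjTranspose]
      congr 1
      ext i
      simp
    have := congrArg Matrix.conjTranspose hA
    rw [Matrix.conjTranspose_sub, Matrix.conjTranspose_mul, Matrix.conjTranspose_mul, hDD,
      Matrix.conjTranspose_smul] at this
    rw [← neg_sub, this]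
    simp
  set E := vfBracketRight (linVF A)
  set F := vfBracketRight (linVF A.conjTranspose)
  set H := -vfBracketRight (linVF D) with hH
  have hEF (U) : E (F U) - F (E U) = H U := by
    change vfBracket (vfBracket U _) _ - vfBracket (vfBracket U _) _ = -vfBracket U _
    rw [vfBracket_jacobi, vfBracket_linVF, hw, vfBracket_skew]
  have hbr (B : Matrix σ σ ℂ) (c : ℂ) (hB : B * D - D * B = c • B) (U) :
      H (vfBracketRight (linVF B) U) - vfBracketRight (linVF B) (H U) =
        c • vfBracketRight (linVF B) U := by
    have h1 := vfBracket_jacobi U (linVF D) (linVF B)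
    rw [vfBracket_linVF, ← neg_sub (B * D), hB, ← neg_smul, linVF_smul, vfBracket_skew _ U,
      vfBracket_smul_right] at h1
    rw [hH, LinearMap.neg_apply, LinearMap.neg_apply, map_neg]
    simp only [vfBracketRight_apply]
    linear_combination (norm := module) h1
  have hHE (U) : H (E U) - E (H U) = (2 : ℂ) • E U := hbr A 2 hA U
  have hHF (U) : H (F U) - F (H U) = (-2 : ℂ) • F U := hbr _ (-2) hA' U
  have hcomm (U) : H (E (F U)) = E (F (H U)) := by
    have h1 := hHE (F U)
    have h2 := congrArg E (hHF U)
    rw [map_sub, map_smul] at h2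
    linear_combination (norm := module) h1 + h2
  let p : Submodule ℂ (σ → MvPolynomial σ ℂ) :=
    homogeneousVF σ (d + 1) ⊓ Module.End.eigenspace (E * F) μ
  have hp : ∀ U ∈ p, H U ∈ p := fun U hU => by
    refine ⟨neg_mem (vfBracket_linVF_mem D hU.1), ?_⟩
    have := Module.End.mem_eigenspace_iff.1 hU.2
    rw [SetLike.mem_coe, Module.End.mem_eigenspace_iff, Module.End.mul_apply, ← hcomm, ← Module.End.mul_apply E,
      this, map_smul]
  have : Module.Finite ℂ (homogeneousVF σ (d + 1)) := .of_fg (homogeneousVF_fg _)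
  have : Module.Finite ℂ p := Submodule.finiteDimensional_of_le inf_le_left
  have : Nontrivial p :=
    ⟨⟨⟨V, hV, Module.End.mem_eigenspace_iff.2 h⟩, 0, fun h0 => hV0 (congrArg Subtype.val h0)⟩⟩
  obtain ⟨c, hc⟩ := Module.End.exists_eigenvalue (H.restrict hp)
  obtain ⟨⟨U, hU⟩, hUc⟩ := hc.exists_hasEigenvector
  have hU0 : U ≠ 0 := fun h0 => hUc.2 (Subtype.ext h0)
  have hHU : H U = c • U := congrArg Subtype.val hUc.apply_eq_smul
  obtain ⟨l, rfl⟩ : ∃ l : ℤ, c = l := by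
    obtain ⟨z, hz⟩ := exists_int_of_vfBracket_diagonal w hU0 (c := -c) (by
      rw [neg_smul, ← hHU]
      exact (neg_neg _).symm)
    exact ⟨-z, by rw [Int.cast_neg, ← hz, neg_neg]⟩
  exact exists_int_of_sl2_weight_vector hEF hHE (p := homogeneousVF σ (d + 1))
    (fun v hv => vfBracket_linVF_mem A hv)
    (fun v _ hv0 μ hμ => re_nonneg_of_box_eigenvalue A hv0 hμ)
    hU.1 hU0 (Module.End.mem_eigenspace_iff.1 hU.2) hHU

end Box

section Blocks

variable {n : ℕ} (k : Fin n → ℕ)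

/-- The matrix of the direct sum of normalized nilpotent blocks of sizes `k j + 1`. -/
noncomputable def blockMatrix :
    Matrix ((j : Fin n) × Fin (k j + 1)) ((j : Fin n) × Fin (k j + 1)) ℂ :=
  fun x y => if x.1 = y.1 ∧ (y.2 : ℕ) = x.2 + 1 then
    ((Real.sqrt (((x.2 + 1) * (k x.1 - x.2) : ℕ) : ℝ) : ℝ) : ℂ) else 0

variable {k}

lemma blockIndex_ext {x y : (j : Fin n) × Fin (k j + 1)} (h : x.1 = y.1)
    (h' : (x.2 : ℕ) = y.2) : x = y := by
  obtain ⟨j, a⟩ := x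
  obtain ⟨j', b⟩ := y
  obtain rfl : j = j' := h
  exact congrArg (Sigma.mk j) (Fin.ext h')

lemma star_blockMatrix (x y : (j : Fin n) × Fin (k j + 1)) :
    star (blockMatrix k x y) = blockMatrix k x y := by
  unfold blockMatrix
  split_ifs
  · exact Complex.conj_ofReal _
  · exact star_zero _

lemma blockMatrix_of_succ {x y : (j : Fin n) × Fin (k j + 1)} (h : x.1 = y.1)
    (h' : (y.2 : ℕ) = x.2 + 1) :
    blockMatrix k x y * blockMatrix k x y = (x.2 + 1) * (k x.1 - x.2) := by
  have hle : (x.2 : ℕ) ≤ k x.1 := Nat.lt_succ_iff.1 x.2.2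
  rw [blockMatrix, if_pos ⟨h, h'⟩, ← Complex.ofReal_mul, Real.mul_self_sqrt (Nat.cast_nonneg _),
    Complex.ofReal_natCast, Nat.cast_mul, Nat.cast_sub hle]
  push_cast
  ring

lemma blockMatrix_of_not {x y : (j : Fin n) × Fin (k j + 1)}
    (h : ¬(x.1 = y.1 ∧ (y.2 : ℕ) = x.2 + 1)) : blockMatrix k x y = 0 :=
  if_neg h

lemma conjTranspose_blockMatrix_mul :
    (blockMatrix k).conjTranspose * blockMatrix k =
      Matrix.diagonal fun x => ((x.2 : ℕ) : ℂ) * (k x.1 + 1 - (x.2 : ℕ)) := by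
  ext x y
  simp only [Matrix.mul_apply, Matrix.conjTranspose_apply, star_blockMatrix]
  by_cases hxy : x = y
  · subst hxy
    rw [Matrix.diagonal_apply_eq]
    by_cases h0 : (x.2 : ℕ) = 0
    · rw [h0, Nat.cast_zero, zero_mul]
      refine Finset.sum_eq_zero fun l _ => ?_
      rw [blockMatrix_of_not (by omega), zero_mul]
    · rw [Finset.sum_eq_single ⟨x.1, ⟨x.2 - 1, by omega⟩⟩]
      · rw [blockMatrix_of_succ (x := ⟨x.1, ⟨x.2 - 1, by omega⟩⟩) (y := x) rfl
          (Nat.sub_one_add_one h0).symm]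
        simp only [Nat.cast_sub (Nat.one_le_iff_ne_zero.2 h0), Nat.cast_one]
        ring
      · intro l _ hl
        rw [blockMatrix_of_not, zero_mul]
        exact fun h => hl (blockIndex_ext h.1 (by change (l.2 : ℕ) = x.2 - 1; omega))
      · exact fun h => absurd (Finset.mem_univ _) h
  · rw [Matrix.diagonal_apply_ne _ hxy]
    refine Finset.sum_eq_zero fun l _ => ?_
    by_cases hx : l.1 = x.1 ∧ (x.2 : ℕ) = l.2 + 1
    · rw [blockMatrix_of_not (y := y), mul_zero]
      exact fun hy => hxy (blockIndex_ext (hx.1.symm.trans hy.1) (hx.2.trans hy.2.symm))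
    · rw [blockMatrix_of_not hx, zero_mul]

lemma blockMatrix_mul_conjTranspose :
    blockMatrix k * (blockMatrix k).conjTranspose =
      Matrix.diagonal fun x => ((x.2 : ℕ) + 1 : ℂ) * (k x.1 - (x.2 : ℕ)) := by
  ext x y
  simp only [Matrix.mul_apply, Matrix.conjTranspose_apply, star_blockMatrix]
  by_cases hxy : x = y
  · subst hxy
    rw [Matrix.diagonal_apply_eq]
    by_cases h0 : (x.2 : ℕ) = k x.1
    · rw [h0, sub_self, mul_zero]
      refine Finset.sum_eq_zero fun l _ => ?_
      rw [blockMatrix_of_not, zero_mul]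
      rintro ⟨h1, h2⟩
      have := congrArg k h1
      omega
    · rw [Finset.sum_eq_single ⟨x.1, ⟨x.2 + 1, by omega⟩⟩]
      · rw [blockMatrix_of_succ (x := x) (y := ⟨x.1, ⟨x.2 + 1, by omega⟩⟩) rfl rfl]
      · intro l _ hl
        rw [blockMatrix_of_not, zero_mul]
        exact fun h => hl (blockIndex_ext h.1.symm h.2)
      · exact fun h => absurd (Finset.mem_univ _) h
  · rw [Matrix.diagonal_apply_ne _ hxy]
    refine Finset.sum_eq_zero fun l _ => ?_
    by_cases hx : x.1 = l.1 ∧ (l.2 : ℕ) = x.2 + 1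
    · rw [blockMatrix_of_not (x := y), mul_zero]
      exact fun hy => hxy (blockIndex_ext (hx.1.trans hy.1.symm) (by omega))
    · rw [blockMatrix_of_not hx, zero_mul]

lemma blockMatrix_mul_diagonal_sub :
    blockMatrix k * Matrix.diagonal (fun x => ((2 * (x.2 : ℕ) - k x.1 : ℤ) : ℂ)) -
      Matrix.diagonal (fun x => ((2 * (x.2 : ℕ) - k x.1 : ℤ) : ℂ)) * blockMatrix k =
        (2 : ℂ) • blockMatrix k := by
  ext x y
  rw [Matrix.sub_apply, Matrix.mul_diagonal, Matrix.diagonal_mul, Matrix.smul_apply, smul_eq_mul]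
  by_cases h : x.1 = y.1 ∧ (y.2 : ℕ) = x.2 + 1
  · rw [h.2, ← congrArg k h.1]
    push_cast
    ring
  · rw [blockMatrix_of_not h]
    simp

lemma linVF_blockMatrix_of_succ {x y : (j : Fin n) × Fin (k j + 1)} (h : x.1 = y.1)
    (h' : (y.2 : ℕ) = x.2 + 1) :
    linVF (blockMatrix k) x =
      ((Real.sqrt (((x.2 + 1) * (k x.1 - x.2) : ℕ) : ℝ) : ℝ) : ℂ) • X y := by
  rw [linVF, Finset.sum_eq_single y]
  · rw [blockMatrix, if_pos ⟨h, h'⟩]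
  · intro l _ hl
    rw [blockMatrix_of_not, zero_smul]
    exact fun hx => hl (blockIndex_ext (hx.1.symm.trans h) (hx.2.trans h'.symm))
  · exact fun h => absurd (Finset.mem_univ _) h

lemma linVF_blockMatrix_of_le {x : (j : Fin n) × Fin (k j + 1)} (h : k x.1 ≤ x.2) :
    linVF (blockMatrix k) x = 0 := by
  refine Finset.sum_eq_zero fun l _ => ?_
  rw [blockMatrix_of_not, zero_smul]
  rintro ⟨h1, h2⟩
  have := congrArg k h1
  omega

end Blocks

/-- Let `N = N_{k₁}(x¹) + ⋯ + N_{k_n}(xⁿ)` be a direct sum of normalized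
nilpotent blocks `N_{k_j}(xʲ) = Σ_{i=1}^{k_j} √(i(k_j+1−i)) xʲ_{i+1} ∂/∂xʲ_i` on `ℂ^m`
(coordinates grouped as `ι = Σ j : Fin n, Fin (k j + 1)`).  For `δ ≥ 1`, let
`d₀ : 𝒱_δ → 𝒱_δ`, `U ↦ [U, N]`, `d₀*` its Fischer adjoint, and `□_δ = d₀ d₀*`.  Then
every nonzero eigenvalue `μ` of `□_δ` is a positive integer; consequently
`√μ ≥ 1`, i.e. `a_δ ≥ 1 = 1/δ⁰` for all `δ`: `N` satisfies the Siegel condition of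
order `(τ, γ) = (0, 1)`. -/
theorem stmt_12 (n : ℕ) (k : Fin n → ℕ)
    (Nvf : ((j : Fin n) × Fin (k j + 1)) →
      MvPolynomial ((j : Fin n) × Fin (k j + 1)) ℂ)
    (hNvf : Nvf = fun x => if h : (x.2 : ℕ) < k x.1 then
      (((Real.sqrt ((((x.2 : ℕ) + 1) * (k x.1 - (x.2 : ℕ)) : ℕ) : ℝ) : ℝ) : ℂ)) •
        X (⟨x.1, ⟨(x.2 : ℕ) + 1, by omega⟩⟩ : (j : Fin n) × Fin (k j + 1))
      else 0) :
    ∀ δ : ℕ, 1 ≤ δ →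
      ∀ (d₀ d₀star : (((j : Fin n) × Fin (k j + 1)) →
          MvPolynomial ((j : Fin n) × Fin (k j + 1)) ℂ) →ₗ[ℂ]
        (((j : Fin n) × Fin (k j + 1)) →
          MvPolynomial ((j : Fin n) × Fin (k j + 1)) ℂ)),
        (∀ U, d₀ U = vfBracket U Nvf) →
        (∀ V, vfIsHomogeneous V (δ + 1) → vfIsHomogeneous (d₀star V) (δ + 1)) →
        (∀ V W, vfIsHomogeneous V (δ + 1) → vfIsHomogeneous W (δ + 1) →
          fischerInnerVF (d₀star V) W = fischerInnerVF V (d₀ W)) →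
        ∀ μ : ℂ, μ ≠ 0 →
          (∃ V, vfIsHomogeneous V (δ + 1) ∧ V ≠ 0 ∧ d₀ (d₀star V) = μ • V) →
          (∃ m : ℕ, 0 < m ∧ μ = (m : ℂ)) ∧ 1 ≤ Real.sqrt μ.re := by
  intro δ _ d₀ d₀star hd₀ hstar hadj μ hμ ⟨V, hV, hV0, hVμ⟩
  have hN : Nvf = linVF (blockMatrix k) := by
    rw [hNvf]
    ext1 x
    split_ifs with h
    · exact (linVF_blockMatrix_of_succ (x := x)
        (y := ⟨x.1, ⟨x.2 + 1, Nat.succ_lt_succ h⟩⟩) rfl rfl).symm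
    · exact (linVF_blockMatrix_of_le (not_lt.1 h)).symm
  have hV' : V ∈ homogeneousVF _ (δ + 1) := mem_homogeneousVF.2 hV
  have hF : d₀star V = vfBracket V (linVF (blockMatrix k).conjTranspose) := by
    by_contra hne
    have hW := mem_homogeneousVF.1 <| sub_mem (mem_homogeneousVF.2 (hstar V hV))
      (vfBracket_linVF_mem (blockMatrix k).conjTranspose hV')
    have := fischerInnerVF_self_re_pos (sub_ne_zero.2 hne)
    rw [fischerInnerVF_sub_left, hadj V _ hV hW, fischerInnerVF_vfBracket_linVF, hd₀, hN,
      sub_self] at this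
    exact lt_irrefl _ this
  rw [hd₀, hN, hF] at hVμ
  obtain ⟨m, rfl⟩ := exists_int_of_box_eigenvalue (blockMatrix k)
    (fun x => 2 * (x.2 : ℕ) - k x.1) (by
      rw [conjTranspose_blockMatrix_mul, blockMatrix_mul_conjTranspose, Matrix.diagonal_sub]
      congr 1
      ext x
      push_cast
      ring) blockMatrix_mul_diagonal_sub hV' hV0 hVμ
  have hnonneg := re_nonneg_of_box_eigenvalue (blockMatrix k) hV0 hVμ
  rw [Complex.intCast_re, Int.cast_nonneg_iff] at hnonneg
  have hm : 0 < m := lt_of_le_of_ne hnonneg fun h => hμ (by rw [← h, Int.cast_zero])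
  refine ⟨⟨m.toNat, by omega, ?_⟩, ?_⟩
  · rw [← Int.cast_natCast, Int.toNat_of_nonneg hnonneg]
  · rw [Real.one_le_sqrt, Complex.intCast_re]
    exact_mod_cast hm
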